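/- Let λ₁,…,λ_N be distinct complex numbers with λ_i − λ_j ∉ {0, 1} for all i ≠ j, and θ₁,…,θ_N ∈ ℂ. Define μ_i = e^{θ_i/2} ∏_{k≠i} (1 − 1/(λ_i − λ_k)²)^{1/4} (for any fixed choice of fourth roots), and let L^{RS} be the matrix with entries L^{RS}_{ij} = μ_i μ_j / (1 + λ_j − λ_i). Then det(L^{RS}) = ∏_{i=1}^N e^{θ_i}. -/

import Mathlib

open Matrix Complex Finset

/-- **Cauchy's determinant formula**. -/
theorem det_of_one_div_sub {K : Type*} [Field K] {n : ℕ} (x y : Fin n → K)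
    (hxy : ∀ i j, x i ≠ y j) :
    (Matrix.of fun i j => 1 / (x i - y j)).det =
      (∏ i, 1 / (x i - y i)) * ∏ i, ∏ j ∈ Ioi i,
        (x j - x i) * (y i - y j) / ((x j - y i) * (x i - y j)) := by
  have hsub i j : x i - y j ≠ 0 := sub_ne_zero.2 (hxy i j)
  induction n with
  | zero => simp
  | succ n ih =>
    let B : Matrix (Fin (n + 1)) (Fin (n + 1)) K := Matrix.of fun i j =>
      Fin.cases (1 / (x 0 - y j))
        (fun i => 1 / (x i.succ - y j) - (x 0 - y 0) / ((x i.succ - y 0) * (x 0 - y j))) i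
    have hdet : (Matrix.of fun i j => 1 / (x i - y j)).det = B.det := by
      refine det_eq_of_forall_row_eq_smul_add_const
        (fun i => Fin.cases 0 (fun i => (x 0 - y 0) / (x i.succ - y 0)) i) 0 rfl ?_
      intro i j
      cases i using Fin.cases with
      | zero => simp [B]
      | succ i =>
        have := hsub i.succ 0
        have := hsub 0 j
        simp only [B, of_apply, Fin.cases_succ, Fin.cases_zero]
        field_simp
        ring
    have hcol (i : Fin n) : B i.succ 0 = 0 := by
      have := hsub i.succ 0
      have := hsub 0 0
      simp only [B, of_apply, Fin.cases_succ]
      field_simp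
      ring
    have hminor : B.submatrix Fin.succ Fin.succ =
        Matrix.of fun i j => (x i.succ - x 0) / (x i.succ - y 0) *
          (Matrix.of fun i j => (y 0 - y j.succ) / (x 0 - y j.succ) *
            (Matrix.of fun i j : Fin n => 1 / (x i.succ - y j.succ)) i j) i j := by
      ext i j
      have := hsub i.succ 0
      have := hsub 0 j.succ
      have := hsub i.succ j.succ
      simp only [B, submatrix_apply, of_apply, Fin.cases_succ]
      field_simp
      ring
    rw [hdet, det_succ_column_zero, Fin.sum_univ_succ]
    simp only [hcol, mul_zero, zero_mul, sum_const_zero, add_zero, Fin.succAbove_zero]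
    rw [hminor, det_mul_column, det_mul_row,
      ih (fun i => x i.succ) (fun i => y i.succ) (fun i j => hxy _ _) (fun i j => hsub _ _)]
    simp only [Fin.prod_univ_succ, Fin.prod_Ioi_zero, Fin.prod_Ioi_succ, prod_div_distrib,
      prod_mul_distrib]
    simp only [B, of_apply, Fin.cases_zero, Fin.val_zero, pow_zero, one_mul]
    simp only [div_eq_mul_inv, mul_inv]
    ring

theorem RS_lax_det {N : ℕ} (l th : Fin N → ℂ)
    (hl : Function.Injective l)
    (hl1 : ∀ i j, i ≠ j → l i - l j ≠ 1)
    (r : Fin N → Fin N → ℂ)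
    (hr4 : ∀ i k, i ≠ k → (r i k) ^ 4 = 1 - 1 / (l i - l k) ^ 2)
    (hrsym : ∀ i k, r i k = r k i)
    (m : Fin N → ℂ)
    (hm : ∀ i, m i = exp (th i / 2) * ∏ k ∈ Finset.univ.erase i, r i k)
    (L : Matrix (Fin N) (Fin N) ℂ)
    (hL : ∀ i j, L i j = m i * m j / (1 + l j - l i)) :
    L.det = ∏ i, exp (th i) := by
  have hne i j : 1 - l i ≠ - l j := by
    intro h
    rcases eq_or_ne i j with rfl | hij
    · exact one_ne_zero (by linear_combination h)
    · exact hl1 i j hij (by linear_combination -h)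
  have hL' : L = Matrix.of fun i j => m i * (Matrix.of fun i j => m j *
      (Matrix.of fun i j => 1 / ((1 - l i) - (- l j))) i j) i j := by
    ext i j
    simp only [hL, of_apply]
    rw [show 1 - l i - -l j = 1 + l j - l i by ring]
    ring
  have hmm : (∏ i, m i) * ∏ i, m i =
      (∏ i, exp (th i)) * ∏ i, ∏ j ∈ Ioi i, (r i j) ^ 4 := by
    have hoff := prod_prod_Ioi_mul_eq_prod_prod_off_diag fun i j => r j i ^ 2
    have hr (i j) : r i j ^ 2 * r j i ^ 2 = r i j ^ 4 := by rw [hrsym j i]; ring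
    simp only [hr] at hoff
    rw [hoff, ← prod_mul_distrib, ← prod_mul_distrib]
    refine prod_congr rfl fun i _ => ?_
    rw [hm, prod_pow, ← compl_singleton, show th i = th i / 2 + th i / 2 by ring, exp_add]
    ring_nf
  rw [hL', det_mul_column, det_mul_row, det_of_one_div_sub _ _ hne, ← mul_assoc, hmm, mul_assoc]
  have hdiag : ∏ i, 1 / (1 - l i - -l i) = 1 := prod_eq_one fun i _ => by simp
  rw [hdiag, one_mul]
  refine mul_eq_left₀ (prod_ne_zero_iff.2 fun i _ => exp_ne_zero _) |>.2 ?_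
  simp only [← prod_mul_distrib]
  refine prod_eq_one fun i _ => prod_eq_one fun j hj => ?_
  have hij : i ≠ j := (mem_Ioi.1 hj).ne
  have h₀ : l i - l j ≠ 0 := sub_ne_zero.2 (hl.ne hij)
  have h₁ := sub_ne_zero.2 (hne i j)
  have h₂ := sub_ne_zero.2 (hne j i)
  rw [hr4 i j hij]
  field_simp
  ring
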